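/- For all real α > -1 and -1/2 < β ≤ 0, define for each integer n ≥ 1 the number σ_n = ((α+β+2)_n/(β+1)_n)·h(1)^{-3}·∫₀¹ (h(1)-h(r))²·r^{β+n-1}(1-r)^α dr (this is the square s_n(T_{α,β})² of the n-th singular value of the operator T_{α,β} = 𝒞∘ℙ_{α,β}). Then lim_{n→∞} n^{2α+2}·σ_n = Γ(3α+3)/((α+1)²·Γ(α+1)·𝓑(α+1,β+1)²). -/

import Mathlib

open MeasureTheory Real Filter

/-- The Beta function. -/
noncomputable def Beta (a b : ℝ) : ℝ := Real.Gamma a * Real.Gamma b / Real.Gamma (a + b)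

/-- The incomplete beta function h(r) = ∫₀^r t^β (1-t)^α dt. -/
noncomputable def hfun (α β : ℝ) (r : ℝ) : ℝ := ∫ t in (0:ℝ)..r, t ^ β * (1 - t) ^ α

/-- The ascending factorial (Pochhammer symbol) (a)_n. -/
noncomputable def poch (a : ℝ) (n : ℕ) : ℝ := Polynomial.eval a (ascPochhammer ℝ n)

/-- σ_n = s_n(T_{α,β})², the squared singular values of T_{α,β} = 𝒞∘ℙ_{α,β}. -/
noncomputable def sigma (α β : ℝ) (n : ℕ) : ℝ :=
  (poch (α+β+2) n / poch (β+1) n) * (hfun α β 1)⁻¹ ^ 3 *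
    ∫ r in (0:ℝ)..1, (hfun α β 1 - hfun α β r) ^ 2 * r ^ (β + (n:ℝ) - 1) * (1 - r) ^ α

lemma tendsto_natCast_div_natCast_add (c : ℝ) :
    Tendsto (fun n : ℕ => (n : ℝ) / (n + c)) atTop (nhds 1) := by
  simpa using tendsto_natCast_div_add_atTop (𝕜 := ℝ) c

lemma eventually_natCast_add_pos (c : ℝ) : ∀ᶠ n : ℕ in atTop, 0 < (n : ℝ) + c := by
  filter_upwards [tendsto_natCast_atTop_atTop.eventually_gt_atTop (-c)] with n hn
  linarith

lemma Gamma_add_nat_eq_prod {a : ℝ} (ha : 0 < a) (n : ℕ) :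
    Real.Gamma (a + n) = Real.Gamma a * ∏ j ∈ Finset.range n, (a + j) := by
  induction n with
  | zero => simp
  | succ n ih =>
    rw [Finset.prod_range_succ, Nat.cast_succ, ← add_assoc, Real.Gamma_add_one (by positivity), ih]
    ring

lemma tendsto_Gamma_nat_add_div_of_pos {c : ℝ} (hc : 0 < c) :
    Tendsto (fun n : ℕ => Real.Gamma (n + c) / (Real.Gamma n * (n : ℝ) ^ c)) atTop (nhds 1) := by
  have hG := (Real.Gamma_pos_of_pos hc).ne'
  have h := ((tendsto_const_nhds (x := Real.Gamma c)).div (Real.GammaSeq_tendsto_Gamma c) hG).mul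
    (tendsto_natCast_div_natCast_add c)
  rw [div_self hG, one_mul] at h
  refine h.congr' ?_
  filter_upwards [eventually_gt_atTop 0] with n hn
  have hn' : (0 : ℝ) < n := by exact_mod_cast hn
  have h1 : Real.Gamma c * ∏ j ∈ Finset.range (n + 1), (c + j) = (n + c) * Real.Gamma (n + c) := by
    rw [← Gamma_add_nat_eq_prod hc, Nat.cast_succ, ← add_assoc, Real.Gamma_add_one (by positivity),
      add_comm c]
  have h2 : (n.factorial : ℝ) = n * Real.Gamma n := by
    rw [← Real.Gamma_add_one hn'.ne', Real.Gamma_nat_eq_factorial]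
  have hp : (0 : ℝ) < ∏ j ∈ Finset.range (n + 1), (c + j) :=
    Finset.prod_pos fun j _ => by positivity
  have h3 : (0 : ℝ) < (n : ℝ) ^ c := Real.rpow_pos_of_pos hn' c
  have h4 := Real.Gamma_pos_of_pos hn'
  have h5 : (n : ℝ) + c ≠ 0 := by positivity
  simp only [Pi.div_apply, Real.GammaSeq, h2]
  rw [div_div_eq_mul_div, h1]
  field_simp

/-- `Γ(n + c) ∼ Γ(n) n ^ c` for every real `c`. -/
lemma tendsto_Gamma_nat_add_div (c : ℝ) :
    Tendsto (fun n : ℕ => Real.Gamma (n + c) / (Real.Gamma n * (n : ℝ) ^ c)) atTop (nhds 1) := by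
  obtain ⟨k, hk⟩ := exists_nat_gt (-c)
  induction k generalizing c with
  | zero => exact tendsto_Gamma_nat_add_div_of_pos (by simpa using hk)
  | succ k ih =>
    have h := (ih (c + 1) (by push_cast at hk; linarith)).mul (tendsto_natCast_div_natCast_add c)
    rw [one_mul] at h
    refine h.congr' ?_
    filter_upwards [eventually_gt_atTop 0, eventually_natCast_add_pos c] with n hn hnc
    have hn' : (0 : ℝ) < n := by exact_mod_cast hn
    rw [← add_assoc, Real.Gamma_add_one hnc.ne', Real.rpow_add_one hn'.ne']
    have h3 : (0 : ℝ) < (n : ℝ) ^ c := Real.rpow_pos_of_pos hn' c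
    have h4 := Real.Gamma_pos_of_pos hn'
    field_simp

lemma tendsto_rpow_mul_Gamma_div_Gamma (c s : ℝ) :
    Tendsto (fun n : ℕ => (n : ℝ) ^ s * (Real.Gamma (n + c) / Real.Gamma (n + c + s))) atTop
      (nhds 1) := by
  have h := (tendsto_Gamma_nat_add_div c).div (tendsto_Gamma_nat_add_div (c + s)) one_ne_zero
  rw [div_one] at h
  refine h.congr' ?_
  filter_upwards [eventually_gt_atTop 0, eventually_natCast_add_pos (c + s)] with n hn hncs
  have hn' : (0 : ℝ) < n := by exact_mod_cast hn
  have h1 := Real.rpow_pos_of_pos hn' c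
  have h2 := Real.rpow_pos_of_pos hn' s
  have h4 := Real.Gamma_pos_of_pos hn'
  have h5 := Real.Gamma_pos_of_pos hncs
  simp only [Pi.div_apply]
  rw [Real.rpow_add hn', ← add_assoc]
  rw [← add_assoc] at h5
  field_simp

lemma tendsto_rpow_mul_Beta (c s : ℝ) :
    Tendsto (fun n : ℕ => (n : ℝ) ^ s * Beta (n + c) s) atTop (nhds (Real.Gamma s)) := by
  have h := (tendsto_rpow_mul_Gamma_div_Gamma c s).mul_const (Real.Gamma s)
  rw [one_mul] at h
  refine h.congr fun n => ?_
  rw [Beta]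
  ring

lemma poch_eq_Gamma_div {a : ℝ} (ha : 0 < a) (n : ℕ) :
    poch a n = Real.Gamma (a + n) / Real.Gamma a := by
  have hG := (Real.Gamma_pos_of_pos ha).ne'
  rw [Gamma_add_nat_eq_prod ha, mul_div_cancel_left₀ _ hG, poch]
  induction n with
  | zero => simp
  | succ n ih => rw [ascPochhammer_succ_eval, ih, Finset.prod_range_succ]

lemma tendsto_rpow_mul_poch_div_poch {a b : ℝ} (ha : 0 < a) (hb : 0 < b) :
    Tendsto (fun n : ℕ => (n : ℝ) ^ (b - a) * (poch a n / poch b n)) atTop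
      (nhds (Real.Gamma b / Real.Gamma a)) := by
  have h := (tendsto_rpow_mul_Gamma_div_Gamma a (b - a)).mul_const (Real.Gamma b / Real.Gamma a)
  rw [one_mul] at h
  refine h.congr fun n => ?_
  have h1 := Real.Gamma_pos_of_pos ha
  have h2 := Real.Gamma_pos_of_pos hb
  rw [poch_eq_Gamma_div ha, poch_eq_Gamma_div hb, add_comm a, add_comm b, add_assoc,
    add_sub_cancel]
  field_simp

lemma ofReal_integrand_of_mem {x : ℝ} (hx : x ∈ Set.Ioc (0 : ℝ) 1) (a b : ℝ) :
    (x : ℂ) ^ ((a : ℂ) - 1) * (1 - (x : ℂ)) ^ ((b : ℂ) - 1) =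
      ((x ^ (a - 1) * (1 - x) ^ (b - 1) : ℝ) : ℂ) := by
  have h1 : (0 : ℝ) ≤ 1 - x := by linarith [hx.2]
  rw [Complex.ofReal_mul, Complex.ofReal_cpow hx.1.le, Complex.ofReal_cpow h1]
  push_cast
  rfl

lemma intervalIntegrable_rpow_mul_one_sub_rpow {a b : ℝ} (ha : 0 < a) (hb : 0 < b) :
    IntervalIntegrable (fun x : ℝ => x ^ (a - 1) * (1 - x) ^ (b - 1)) volume 0 1 := by
  have h := Complex.betaIntegral_convergent (u := a) (v := b) (by simpa) (by simpa)
  rw [intervalIntegrable_iff_integrableOn_Ioc_of_le zero_le_one] at h ⊢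
  refine (h.re).congr ?_
  filter_upwards [ae_restrict_mem measurableSet_Ioc] with x hx
  rw [ofReal_integrand_of_mem hx]
  exact Complex.ofReal_re _

lemma integral_rpow_mul_one_sub_rpow {a b : ℝ} (ha : 0 < a) (hb : 0 < b) :
    ∫ x in (0:ℝ)..1, x ^ (a - 1) * (1 - x) ^ (b - 1) = Beta a b := by
  have h : Complex.betaIntegral a b =
      ((∫ x in (0:ℝ)..1, x ^ (a - 1) * (1 - x) ^ (b - 1) : ℝ) : ℂ) := by
    rw [Complex.betaIntegral, ← intervalIntegral.integral_ofReal]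
    refine intervalIntegral.integral_congr_ae (Eventually.of_forall fun x hx => ?_)
    rw [Set.uIoc_of_le zero_le_one] at hx
    exact ofReal_integrand_of_mem hx a b
  have h' := ProbabilityTheory.beta_eq_betaIntegralReal a b ha hb
  rw [h, Complex.ofReal_re] at h'
  exact h'.symm

lemma hfun_one {α β : ℝ} (hα : -1 < α) (hβ : -1 < β) : hfun α β 1 = Beta (α + 1) (β + 1) := by
  have h := integral_rpow_mul_one_sub_rpow (a := β + 1) (b := α + 1) (by linarith) (by linarith)
  simp only [add_sub_cancel_right] at h
  rw [hfun, h, Beta, Beta, mul_comm, add_comm (β + 1)]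

lemma intervalIntegrable_hfun {α β : ℝ} (hα : -1 < α) (hβ : -1 < β) :
    IntervalIntegrable (fun t : ℝ => t ^ β * (1 - t) ^ α) volume 0 1 := by
  simpa using intervalIntegrable_rpow_mul_one_sub_rpow (a := β + 1) (b := α + 1)
    (by linarith) (by linarith)

lemma integral_one_sub_rpow {α : ℝ} (hα : -1 < α) (r : ℝ) :
    ∫ t in r..1, (1 - t) ^ α = (1 - r) ^ (α + 1) / (α + 1) := by
  rw [intervalIntegral.integral_comp_sub_left (fun t => t ^ α), sub_self,
    integral_rpow (Or.inl hα), Real.zero_rpow (by linarith), sub_zero]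

lemma hfun_one_sub_hfun_bounds {α β r : ℝ} (hα : -1 < α) (hβ : -1 < β) (hβ' : β ≤ 0)
    (hr : r ∈ Set.Ioo (0 : ℝ) 1) :
    (1 - r) ^ (α + 1) / (α + 1) ≤ hfun α β 1 - hfun α β r ∧
      hfun α β 1 - hfun α β r ≤ r ^ β * ((1 - r) ^ (α + 1) / (α + 1)) := by
  have hint := intervalIntegrable_hfun hα hβ
  have hI : ∀ {f : ℝ → ℝ} {a b : ℝ}, IntervalIntegrable f volume 0 1 → a ∈ Set.Icc (0 : ℝ) 1 →
      b ∈ Set.Icc (0 : ℝ) 1 → IntervalIntegrable f volume a b := fun hf ha hb =>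
    hf.mono_set (Set.uIcc_subset_uIcc (by rwa [Set.uIcc_of_le zero_le_one])
      (by rwa [Set.uIcc_of_le zero_le_one]))
  have hr' : r ∈ Set.Icc (0 : ℝ) 1 := ⟨hr.1.le, hr.2.le⟩
  have h0 : (0 : ℝ) ∈ Set.Icc (0 : ℝ) 1 := by simp
  have h1 : (1 : ℝ) ∈ Set.Icc (0 : ℝ) 1 := by simp
  have hα' : IntervalIntegrable (fun t : ℝ => (1 - t) ^ α) volume 0 1 := by
    simpa using intervalIntegrable_hfun hα (β := 0) (by norm_num)
  have hsub : hfun α β 1 - hfun α β r = ∫ t in r..1, t ^ β * (1 - t) ^ α :=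
    intervalIntegral.integral_interval_sub_left hint (hI hint h0 hr')
  rw [hsub, ← integral_one_sub_rpow hα, ← intervalIntegral.integral_const_mul]
  constructor
  · refine intervalIntegral.integral_mono_on hr.2.le (hI hα' hr' h1) (hI hint hr' h1)
      fun t ht => ?_
    exact le_mul_of_one_le_left (Real.rpow_nonneg (by linarith [ht.2]) _)
      (Real.one_le_rpow_of_pos_of_le_one_of_nonpos (hr.1.trans_le ht.1) ht.2 hβ')
  · refine intervalIntegral.integral_mono_on hr.2.le (hI hint hr' h1)
      ((hI hα' hr' h1).const_mul _) fun t ht => ?_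
    exact mul_le_mul_of_nonneg_right (Real.rpow_le_rpow_of_nonpos hr.1 ht.1 hβ')
      (Real.rpow_nonneg (by linarith [ht.2]) _)

lemma sq_hfun_mul_bounds {α β r : ℝ} (hα : -1 < α) (hβ : -1 < β) (hβ' : β ≤ 0)
    (hr : r ∈ Set.Ioo (0 : ℝ) 1) (c : ℝ) :
    (1 / (α + 1) ^ 2) * (r ^ (c - 1) * (1 - r) ^ (3 * α + 3 - 1)) ≤
        (hfun α β 1 - hfun α β r) ^ 2 * r ^ (c - 1) * (1 - r) ^ α ∧
      (hfun α β 1 - hfun α β r) ^ 2 * r ^ (c - 1) * (1 - r) ^ α ≤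
        (1 / (α + 1) ^ 2) * (r ^ (c + 2 * β - 1) * (1 - r) ^ (3 * α + 3 - 1)) := by
  obtain ⟨hl, hu⟩ := hfun_one_sub_hfun_bounds hα hβ hβ' hr
  have h1 : 0 < 1 - r := by linarith [hr.2]
  have hα1 : 0 < α + 1 := by linarith
  have hp : 0 < (1 - r) ^ (α + 1) / (α + 1) := div_pos (Real.rpow_pos_of_pos h1 _) hα1
  have hw1 : 0 ≤ r ^ (c - 1) := Real.rpow_nonneg hr.1.le _
  have hw2 : 0 ≤ (1 - r) ^ α := Real.rpow_nonneg h1.le _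
  have e1 : (1 - r) ^ (3 * α + 3 - 1) = ((1 - r) ^ (α + 1)) ^ 2 * (1 - r) ^ α := by
    rw [← Real.rpow_mul_natCast h1.le, ← Real.rpow_add h1]
    congr 1
    push_cast
    ring
  have e2 : r ^ (c + 2 * β - 1) = (r ^ β) ^ 2 * r ^ (c - 1) := by
    rw [← Real.rpow_mul_natCast hr.1.le, ← Real.rpow_add hr.1]
    congr 1
    push_cast
    ring
  rw [mul_assoc, e1, e2]
  constructor
  · calc _ = ((1 - r) ^ (α + 1) / (α + 1)) ^ 2 * (r ^ (c - 1) * (1 - r) ^ α) := by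
          field_simp
      _ ≤ _ := by gcongr
  · calc _ ≤ (r ^ β * ((1 - r) ^ (α + 1) / (α + 1))) ^ 2 * (r ^ (c - 1) * (1 - r) ^ α) := by
          have := hp.le.trans hl
          gcongr
      _ = _ := by field_simp

lemma integral_sq_hfun_bounds {α β c : ℝ} (hα : -1 < α) (hβ : -1 < β) (hβ' : β ≤ 0)
    (hc : 0 < c + 2 * β) :
    (1 / (α + 1) ^ 2) * Beta c (3 * α + 3) ≤
        ∫ r in (0:ℝ)..1, (hfun α β 1 - hfun α β r) ^ 2 * r ^ (c - 1) * (1 - r) ^ α ∧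
      ∫ r in (0:ℝ)..1, (hfun α β 1 - hfun α β r) ^ 2 * r ^ (c - 1) * (1 - r) ^ α ≤
        (1 / (α + 1) ^ 2) * Beta (c + 2 * β) (3 * α + 3) := by
  have hs : 0 < 3 * α + 3 := by linarith
  have hc' : 0 < c := by linarith
  have hL := (intervalIntegrable_rpow_mul_one_sub_rpow hc' hs).const_mul (1 / (α + 1) ^ 2)
  have hU := (intervalIntegrable_rpow_mul_one_sub_rpow hc hs).const_mul (1 / (α + 1) ^ 2)
  have hcont : ContinuousOn (hfun α β) (Set.Icc 0 1) := by
    have h := intervalIntegrable_hfun hα hβ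
    rw [intervalIntegrable_iff_integrableOn_Icc_of_le zero_le_one] at h
    rw [← Set.uIcc_of_le zero_le_one] at h ⊢
    exact intervalIntegral.continuousOn_primitive_interval h
  have hM : IntervalIntegrable
      (fun r => (hfun α β 1 - hfun α β r) ^ 2 * r ^ (c - 1) * (1 - r) ^ α) volume 0 1 := by
    rw [intervalIntegrable_iff_integrableOn_Ioo_of_le zero_le_one] at hU ⊢
    refine Integrable.mono' hU ?_ ?_
    · have h1 : AEStronglyMeasurable (hfun α β) (volume.restrict (Set.Ioo 0 1)) :=
        (hcont.mono Set.Ioo_subset_Icc_self).aestronglyMeasurable measurableSet_Ioo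
      have h2 : Measurable fun r : ℝ => r ^ (c - 1) := by fun_prop
      have h3 : Measurable fun r : ℝ => (1 - r) ^ α := by fun_prop
      exact (((aestronglyMeasurable_const.sub h1).pow 2).mul h2.aestronglyMeasurable).mul
        h3.aestronglyMeasurable
    · filter_upwards [ae_restrict_mem measurableSet_Ioo] with r hr
      have h1 : 0 ≤ (1 - r) ^ α := Real.rpow_nonneg (by linarith [hr.2]) _
      have h2 : 0 ≤ r ^ (c - 1) := Real.rpow_nonneg hr.1.le _
      rw [Real.norm_of_nonneg (by positivity)]
      exact (sq_hfun_mul_bounds hα hβ hβ' hr c).2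
  rw [← integral_rpow_mul_one_sub_rpow hc' hs, ← integral_rpow_mul_one_sub_rpow hc hs,
    ← intervalIntegral.integral_const_mul, ← intervalIntegral.integral_const_mul]
  exact ⟨intervalIntegral.integral_mono_on_of_le_Ioo zero_le_one hL hM
      fun r hr => (sq_hfun_mul_bounds hα hβ hβ' hr c).1,
    intervalIntegral.integral_mono_on_of_le_Ioo zero_le_one hM hU
      fun r hr => (sq_hfun_mul_bounds hα hβ hβ' hr c).2⟩

lemma tendsto_rpow_mul_integral_sq_hfun {α β : ℝ} (hα : -1 < α) (hβ : -1 < β) (hβ' : β ≤ 0) :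
    Tendsto (fun n : ℕ => (n : ℝ) ^ (3 * α + 3) *
        ∫ r in (0:ℝ)..1, (hfun α β 1 - hfun α β r) ^ 2 * r ^ (β + (n:ℝ) - 1) * (1 - r) ^ α) atTop
      (nhds (1 / (α + 1) ^ 2 * Real.Gamma (3 * α + 3))) := by
  refine tendsto_of_tendsto_of_tendsto_of_le_of_le'
    ((tendsto_rpow_mul_Beta β (3 * α + 3)).const_mul (1 / (α + 1) ^ 2))
    ((tendsto_rpow_mul_Beta (β + 2 * β) (3 * α + 3)).const_mul (1 / (α + 1) ^ 2)) ?_ ?_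
  all_goals
    filter_upwards [eventually_natCast_add_pos (β + 2 * β)] with n hn
    obtain ⟨hl, hu⟩ := integral_sq_hfun_bounds (c := n + β) hα hβ hβ' (by linarith)
    rw [add_assoc] at hu
    rw [add_comm β (n : ℝ), mul_left_comm]
    gcongr

/-- lim_{n→∞} n^{2α+2}·s_n(T_{α,β})² = Γ(3α+3)/((α+1)²Γ(α+1)𝓑(α+1,β+1)²). -/
theorem singular_values_T_asymptotics (α β : ℝ) (hα : -1 < α) (hβ1 : -(1/2 : ℝ) < β)
    (hβ2 : β ≤ 0) :
    Tendsto (fun n : ℕ => (n:ℝ) ^ (2*α + 2) * sigma α β n) atTop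
      (nhds (Real.Gamma (3*α + 3) /
        ((α + 1) ^ 2 * Real.Gamma (α + 1) * Beta (α+1) (β+1) ^ 2))) := by
  have hβ : -1 < β := by linarith
  have hα1 : 0 < α + 1 := by linarith
  have hβ1' : 0 < β + 1 := by linarith
  have hab : 0 < α + β + 2 := by linarith
  have hGα := Real.Gamma_pos_of_pos hα1
  have hGβ := Real.Gamma_pos_of_pos hβ1'
  have hGab := Real.Gamma_pos_of_pos hab
  have h := ((tendsto_rpow_mul_poch_div_poch hab hβ1').mul_const
    ((hfun α β 1)⁻¹ ^ 3)).mul (tendsto_rpow_mul_integral_sq_hfun hα hβ hβ2)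
  have hlim : Real.Gamma (3*α + 3) / ((α + 1) ^ 2 * Real.Gamma (α + 1) * Beta (α+1) (β+1) ^ 2) =
      Real.Gamma (β + 1) / Real.Gamma (α + β + 2) * (hfun α β 1)⁻¹ ^ 3 *
        (1 / (α + 1) ^ 2 * Real.Gamma (3 * α + 3)) := by
    rw [hfun_one hα hβ, Beta, show α + 1 + (β + 1) = α + β + 2 by ring]
    field_simp
  rw [hlim]
  refine h.congr' ?_
  filter_upwards [eventually_gt_atTop 0] with n hn
  have hn' : (0 : ℝ) < n := by exact_mod_cast hn
  have he : (n : ℝ) ^ (2 * α + 2) = (n : ℝ) ^ (β + 1 - (α + β + 2)) * (n : ℝ) ^ (3 * α + 3) := by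
    rw [← Real.rpow_add hn']
    congr 1
    ring
  rw [sigma, he]
  ring
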